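/- arXiv:1706.00817 — 2 statements merged into one kernel-verified Lean document; each statement's English description precedes it below -/
import Mathlib

section
/- There are exactly 2880 group homomorphisms φ: B → S₆ such that φ(σ) is the fixed transposition (1 2), and the image of φ is a transitive subgroup of S₆. -/
/-- Generators of the braid group `B₂(C₂)` in Bellingeri's presentation. -/
inductive Gen : Type
  | a1 | a2 | b1 | b2 | s
  deriving DecidableEq

namespace Braid

open FreeGroup

abbrev A1 : FreeGroup Gen := FreeGroup.of Gen.a1
abbrev A2 : FreeGroup Gen := FreeGroup.of Gen.a2
abbrev B1 : FreeGroup Gen := FreeGroup.of Gen.b1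
abbrev B2 : FreeGroup Gen := FreeGroup.of Gen.b2
abbrev Sg : FreeGroup Gen := FreeGroup.of Gen.s

/-- The eleven relations (R2), (R3), (R4), (TR) of Bellingeri's presentation,
written as words that are set equal to `1`. -/
def rels : Set (FreeGroup Gen) :=
  { Sg⁻¹ * A1 * Sg⁻¹ * A1 * (A1 * Sg⁻¹ * A1 * Sg⁻¹)⁻¹,
    Sg⁻¹ * A2 * Sg⁻¹ * A2 * (A2 * Sg⁻¹ * A2 * Sg⁻¹)⁻¹,
    Sg⁻¹ * B1 * Sg⁻¹ * B1 * (B1 * Sg⁻¹ * B1 * Sg⁻¹)⁻¹,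
    Sg⁻¹ * B2 * Sg⁻¹ * B2 * (B2 * Sg⁻¹ * B2 * Sg⁻¹)⁻¹,
    Sg⁻¹ * A1 * Sg * A2 * (A2 * Sg⁻¹ * A1 * Sg)⁻¹,
    Sg⁻¹ * B1 * Sg * B2 * (B2 * Sg⁻¹ * B1 * Sg)⁻¹,
    Sg⁻¹ * A1 * Sg * B2 * (B2 * Sg⁻¹ * A1 * Sg)⁻¹,
    Sg⁻¹ * B1 * Sg * A2 * (A2 * Sg⁻¹ * B1 * Sg)⁻¹,
    Sg⁻¹ * A1 * Sg⁻¹ * B1 * (B1 * Sg⁻¹ * A1 * Sg)⁻¹,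
    Sg⁻¹ * A2 * Sg⁻¹ * B2 * (B2 * Sg⁻¹ * A2 * Sg)⁻¹,
    (A1 * B1⁻¹ * A1⁻¹ * B1) * (A2 * B2⁻¹ * A2⁻¹ * B2) * (Sg * Sg)⁻¹ }

/-- The group `B`, isomorphic to the braid group `B₂(C₂)` on two strings
on a genus `2` surface. -/
abbrev B : Type := PresentedGroup rels

/-- The image of the generator `σ` in `B`. -/
def σB : B := PresentedGroup.of Gen.s

/-- A generic monodromy representation of `B` in `Sₙ`: a homomorphism
`φ : B → Sₙ` such that `φ(σ)` is a transposition and the image of `φ` is a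
transitive subgroup of `Sₙ`. -/
def IsGeneric (n : ℕ) (φ : B →* Equiv.Perm (Fin n)) : Prop :=
  (φ σB).IsSwap ∧ ∀ i j : Fin n, ∃ g : B, φ g i = j

end Braid

open Braid

namespace Braid

open Equiv

section IrreduciblePair

variable {α : Type*} [DecidableEq α] {p q : α} {H : Subgroup (Perm α)}

/-- `H` commutes elementwise with its conjugate by the transposition `(p q)`. -/
def CommutesWithConj (p q : α) (H : Subgroup (Perm α)) : Prop :=
  ∀ x ∈ H, ∀ y ∈ H, x * (swap p q * y * swap p q) = swap p q * y * swap p q * x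

/-- The group generated by `H` and `(p q)` is transitive. -/
def TransitiveWithSwap (p q : α) (H : Subgroup (Perm α)) : Prop :=
  ∀ U : Set α, (∀ x ∈ H, ∀ i ∈ U, x i ∈ U) → (∀ i ∈ U, swap p q i ∈ U) → ∀ i ∈ U, ∀ j, j ∈ U

theorem CommutesWithConj.apply (hc : CommutesWithConj p q H) {x y : Perm α} (hx : x ∈ H)
    (hy : y ∈ H) (i : α) :
    x (swap p q (y (swap p q i))) = swap p q (y (swap p q (x i))) := by
  simpa using DFunLike.congr_fun (hc x hx y hy) i

theorem CommutesWithConj.exists_apply (hc : CommutesWithConj p q H)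
    (ht : TransitiveWithSwap p q H) {i : α} (hi : swap p q i = i) (j : α) :
    ∃ x ∈ H, ∃ y ∈ H, x (swap p q (y i)) = j := by
  refine ht {j | ∃ x ∈ H, ∃ y ∈ H, x (swap p q (y i)) = j} ?_ ?_ i
    ⟨1, H.one_mem, 1, H.one_mem, by simpa using hi⟩ j
  · rintro z hz _ ⟨x, hx, y, hy, rfl⟩
    exact ⟨z * x, H.mul_mem hz hx, y, hy, rfl⟩
  · rintro _ ⟨x, hx, y, hy, rfl⟩
    refine ⟨y, hy, x, hx, ?_⟩
    have h := hc.apply hy hx i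
    rw [hi] at h
    rw [h]

/-- If `p` and `q` lie in different `H`-orbits, the orbit of `p` has at most one further point. -/
theorem CommutesWithConj.eq_of_mem_orbit (hc : CommutesWithConj p q H)
    (ht : TransitiveWithSwap p q H) (hpq : ∀ x ∈ H, x p ≠ q) {i j : α}
    (hi : i ≠ p ∧ i ≠ q) (hj : j ≠ p ∧ j ≠ q) (hpi : ∃ x ∈ H, x p = i) (hpj : ∃ x ∈ H, x p = j) :
    i = j := by
  have aux : ∀ {k : α}, (∃ x ∈ H, x p = k) → ∀ {y}, y ∈ H →
      (∃ x ∈ H, x (swap p q (y k)) = q) → y k = p := by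
    rintro k ⟨z, hz, rfl⟩ y hy ⟨x, hx, h⟩
    by_contra hne
    rw [swap_apply_of_ne_of_ne hne (hpq (y * z) (H.mul_mem hy hz))] at h
    exact hpq (x * (y * z)) (H.mul_mem hx (H.mul_mem hy hz)) h
  obtain ⟨x, hx, y, hy, h⟩ := hc.exists_apply ht (swap_apply_of_ne_of_ne hi.1 hi.2) q
  have hyi : y i = p := aux hpi hy ⟨x, hx, h⟩
  have hyj : y j = p := by
    obtain ⟨u, hu, rfl⟩ := hpi
    obtain ⟨v, hv, rfl⟩ := hpj
    refine aux ⟨v, hv, rfl⟩ hy ⟨u * v⁻¹, H.mul_mem hu (H.inv_mem hv), ?_⟩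
    have e := hc.apply (H.mul_mem hu (H.inv_mem hv)) hy (v p)
    rw [swap_apply_of_ne_of_ne hj.1 hj.2] at e
    rw [e]
    simp [swap_apply_of_ne_of_ne hi.1 hi.2, hyi]
  exact y.injective (hyi.trans hyj.symm)

theorem CommutesWithConj.symm (hc : CommutesWithConj p q H) : CommutesWithConj q p H := by
  simpa only [CommutesWithConj, swap_comm q p] using hc

theorem TransitiveWithSwap.symm (ht : TransitiveWithSwap p q H) : TransitiveWithSwap q p H := by
  simpa only [TransitiveWithSwap, swap_comm q p] using ht

theorem TransitiveWithSwap.exists_apply_eq_or (ht : TransitiveWithSwap p q H) (i : α) :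
    (∃ x ∈ H, x p = i) ∨ ∃ x ∈ H, x q = i := by
  by_contra! hne
  have hmem : ∀ j, ∃ x ∈ H, x i = j := by
    refine ht {j | ∃ x ∈ H, x i = j} ?_ ?_ i ⟨1, H.one_mem, rfl⟩
    · rintro z hz _ ⟨x, hx, rfl⟩
      exact ⟨z * x, H.mul_mem hz hx, rfl⟩
    · rintro _ ⟨x, hx, rfl⟩
      refine ⟨x, hx, (swap_apply_of_ne_of_ne ?_ ?_).symm⟩
      · exact fun h => hne.1 x⁻¹ (H.inv_mem hx) (by simp [← h])
      · exact fun h => hne.2 x⁻¹ (H.inv_mem hx) (by simp [← h])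
  obtain ⟨x, hx, h⟩ := hmem p
  exact hne.1 x⁻¹ (H.inv_mem hx) (by simp [← h])

/-- On at least five points `H` itself is transitive. -/
theorem CommutesWithConj.transitive (hc : CommutesWithConj p q H)
    (ht : TransitiveWithSwap p q H) {i j k : α} (hi : i ≠ p ∧ i ≠ q) (hj : j ≠ p ∧ j ≠ q)
    (hk : k ≠ p ∧ k ≠ q) (hij : i ≠ j) (hik : i ≠ k) (hjk : j ≠ k) (l m : α) :
    ∃ x ∈ H, x l = m := by
  have hpq : ∃ x ∈ H, x p = q := by
    by_contra! hpq
    have hqp : ∀ x ∈ H, x q ≠ p := fun x hx h =>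
      hpq x⁻¹ (H.inv_mem hx) (by simp [← h])
    have eqp := fun {a b : α} => hc.eq_of_mem_orbit ht hpq (i := a) (j := b)
    have eqq := fun {a b : α} ha hb =>
      hc.symm.eq_of_mem_orbit ht.symm hqp (i := a) (j := b) (And.symm ha) (And.symm hb)
    rcases ht.exists_apply_eq_or i with h₁ | h₁ <;> rcases ht.exists_apply_eq_or j with h₂ | h₂ <;>
      rcases ht.exists_apply_eq_or k with h₃ | h₃
    · exact hij (eqp hi hj h₁ h₂)
    · exact hij (eqp hi hj h₁ h₂)
    · exact hik (eqp hi hk h₁ h₃)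
    · exact hjk (eqq hj hk h₂ h₃)
    · exact hjk (eqp hj hk h₂ h₃)
    · exact hik (eqq hi hk h₁ h₃)
    · exact hij (eqq hi hj h₁ h₂)
    · exact hij (eqq hi hj h₁ h₂)
  have hp : ∀ m, ∃ x ∈ H, x p = m := by
    refine ht {m | ∃ x ∈ H, x p = m} ?_ ?_ p ⟨1, H.one_mem, rfl⟩
    · rintro z hz _ ⟨x, hx, rfl⟩
      exact ⟨z * x, H.mul_mem hz hx, rfl⟩
    · rintro m hm
      by_cases h₁ : m = p
      · simpa [h₁] using hpq
      by_cases h₂ : m = q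
      · exact ⟨1, H.one_mem, by simp [h₂]⟩
      · rwa [swap_apply_of_ne_of_ne h₁ h₂]
  obtain ⟨x, hx, rfl⟩ := hp l
  obtain ⟨y, hy, rfl⟩ := hp m
  exact ⟨y * x⁻¹, H.mul_mem hy (H.inv_mem hx), by simp⟩

theorem CommutesWithConj.eq_one_of_apply_eq (hc : CommutesWithConj p q H)
    (htr : ∀ l m, ∃ x ∈ H, x l = m) {x : Perm α} (hx : x ∈ H) {i : α} (hi : x i = i) : x = 1 := by
  ext j
  obtain ⟨y, hy, h⟩ := htr (swap p q i) (swap p q j)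
  have e := hc.apply hx hy i
  rw [hi, h] at e
  simpa using e

end IrreduciblePair

section DihedralGroupThree

theorem DihedralGroup.three_eq_top {K : Subgroup (DihedralGroup 3)} {x y : DihedralGroup 3}
    (hx : x ∈ K) (hy : y ∈ K) (hxy : x * y ≠ y * x) : K = ⊤ := by
  have key : ∀ x y : DihedralGroup 3, x * y ≠ y * x → ∀ g, g = 1 ∨ g = x ∨ g = y ∨ g = x * y ∨
      g = y * x ∨ g = x * y * x ∨ g = x * x ∨ g = y * y := by decide +kernel
  refine eq_top_iff.2 fun g _ => ?_
  rcases key x y hxy g with rfl | rfl | rfl | rfl | rfl | rfl | rfl | rfl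
  exacts [K.one_mem, hx, hy, K.mul_mem hx hy, K.mul_mem hy hx, K.mul_mem (K.mul_mem hx hy) hx,
    K.mul_mem hx hx, K.mul_mem hy hy]

/-- A labelling of `Fin 6` by `DihedralGroup 3` in which `(0 1)` becomes inversion. -/
def baseLabel : DihedralGroup 3 ≃ Fin 6 where
  toFun
    | .r k => (![2, 0, 1] : Fin 3 → Fin 6) k
    | .sr k => (![3, 4, 5] : Fin 3 → Fin 6) k
  invFun := ![.r 1, .r 2, .r 0, .sr 0, .sr 1, .sr 2]
  left_inv := by decide
  right_inv := by decide

/-- Representatives, up to automorphisms of `DihedralGroup 3`, of the labellings of `Fin 6`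
in which `(0 1)` becomes inversion. -/
def label (i : Fin 4 × Bool) : DihedralGroup 3 ≃ Fin 6 :=
  baseLabel.trans
    ((if i.2 then swap 4 5 else 1).trans (swap 2 ((![2, 3, 4, 5] : Fin 4 → Fin 6) i.1)))

/-- The left regular representation of `DihedralGroup 3` on `Fin 6` given by a labelling. -/
def regularRep (i : Fin 4 × Bool) : DihedralGroup 3 →* Perm (Fin 6) :=
  (label i).permCongrHom.toMonoidHom.comp
    (MulAction.toPermHom (DihedralGroup 3) (DihedralGroup 3))

theorem regularRep_commutes : ∀ i g g', regularRep i g * (swap 0 1 * regularRep i g' * swap 0 1) =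
    swap 0 1 * regularRep i g' * swap 0 1 * regularRep i g := by decide +kernel

theorem regularRep_transitive : ∀ i j k, ∃ g, regularRep i g j = k := by decide +kernel

theorem regularRep_injective (i : Fin 4 × Bool) : Function.Injective (regularRep i) := by
  have key : ∀ i g g', regularRep i g = regularRep i g' → g = g' := by decide +kernel
  exact fun g g' => key i g g'

theorem eq_of_regularRep_r_one : ∀ i j g, regularRep i (.r 1) = regularRep j g → i = j := by
  decide +kernel

/-- Solutions in `DihedralGroup 3` of the surface relation of genus two which do not commute
pairwise. -/
def nonabelianTuples :
    Finset (DihedralGroup 3 × DihedralGroup 3 × DihedralGroup 3 × DihedralGroup 3) :=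
  {w | (w.1 * w.2.2.1⁻¹ * w.1⁻¹ * w.2.2.1) * (w.2.1 * w.2.2.2⁻¹ * w.2.1⁻¹ * w.2.2.2) = 1 ∧
    ¬ (w.1 * w.2.1 = w.2.1 * w.1 ∧ w.1 * w.2.2.1 = w.2.2.1 * w.1 ∧
      w.1 * w.2.2.2 = w.2.2.2 * w.1 ∧ w.2.1 * w.2.2.1 = w.2.2.1 * w.2.1 ∧
      w.2.1 * w.2.2.2 = w.2.2.2 * w.2.1 ∧ w.2.2.1 * w.2.2.2 = w.2.2.2 * w.2.2.1)}

theorem card_nonabelianTuples : nonabelianTuples.card = 360 := by decide +kernel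

theorem eq_top_of_mem_nonabelianTuples {w} (hw : w ∈ nonabelianTuples)
    {K : Subgroup (DihedralGroup 3)} (h₁ : w.1 ∈ K) (h₂ : w.2.1 ∈ K) (h₃ : w.2.2.1 ∈ K)
    (h₄ : w.2.2.2 ∈ K) : K = ⊤ := by
  by_contra hK
  have key : ∀ {x y}, x ∈ K → y ∈ K → x * y = y * x := fun hx hy =>
    not_not.1 fun hxy => hK (DihedralGroup.three_eq_top hx hy hxy)
  rw [nonabelianTuples, Finset.mem_filter] at hw
  exact hw.2.2 ⟨key h₁ h₂, key h₁ h₃, key h₁ h₄, key h₂ h₃, key h₂ h₄, key h₃ h₄⟩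

end DihedralGroupThree

section Classification

theorem eq_regularRep_r_one : ∀ h : Perm (Fin 6), h 0 = 1 → (∀ i, h i ≠ i) →
    h * (swap 0 1 * h * swap 0 1) = swap 0 1 * h * swap 0 1 * h →
    ((h * h) 0 = 0 → h * h = 1) → ((h * h * h) 0 = 0 → h * h * h = 1) →
    h 1 = 0 ∨ ∃ i, h = regularRep i (.r 1) := by decide +kernel

set_option synthInstance.maxSize 1024 in
theorem apply_one_ne_zero : ∀ h : Perm (Fin 6), h 0 = 1 → h 1 = 0 → (∀ i, h i ≠ i) → h * h = 1 →
    ∀ x : Perm (Fin 6), x 0 = 2 → (∀ i, x i ≠ i) → (∀ i, (h * x) i ≠ i) →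
    x * (swap 0 1 * h * swap 0 1) = swap 0 1 * h * swap 0 1 * x →
    x * (swap 0 1 * x * swap 0 1) = swap 0 1 * x * swap 0 1 * x →
    ¬ ∀ i, (x * x) i = i → x * x = 1 := by decide +kernel

set_option synthInstance.maxSize 1024 in
theorem eq_regularRep_sr_zero : ∀ i, ∀ x : Perm (Fin 6), x (label i 1) = label i (.sr 0) →
    x * (swap 0 1 * regularRep i (.r 1) * swap 0 1) =
      swap 0 1 * regularRep i (.r 1) * swap 0 1 * x →
    x * (swap 0 1 * x * swap 0 1) = swap 0 1 * x * swap 0 1 * x →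
    (∀ j, x j ≠ j) → (∀ j, (x * x) j = j → x * x = 1) →
    x = regularRep i (.sr 0) := by decide +kernel

theorem CommutesWithConj.exists_eq_range {H : Subgroup (Perm (Fin 6))}
    (hc : CommutesWithConj 0 1 H) (ht : TransitiveWithSwap 0 1 H) :
    ∃ i, H = (regularRep i).range := by
  have htr : ∀ l m, ∃ x ∈ H, x l = m :=
    hc.transitive ht (i := 2) (j := 3) (k := 4) (by decide) (by decide) (by decide) (by decide)
      (by decide) (by decide)
  have hone : ∀ x ∈ H, ∀ i, x i = i → x = 1 := fun x hx i => hc.eq_one_of_apply_eq htr hx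
  have hne : ∀ x ∈ H, ∀ l, x l ≠ l → ∀ i, x i ≠ i := fun x hx l hl i hi =>
    hl (by rw [hone x hx i hi]; rfl)
  obtain ⟨h, hh, h01⟩ := htr 0 1
  have hhf := hne h hh 0 (by rw [h01]; decide)
  obtain ⟨i, rfl⟩ : ∃ i, h = regularRep i (.r 1) := by
    refine (eq_regularRep_r_one h h01 hhf (hc h hh h hh) (hone _ (H.mul_mem hh hh) 0)
      (hone _ (H.mul_mem (H.mul_mem hh hh) hh) 0)).resolve_left fun h10 => ?_
    obtain ⟨x, hx, hx02⟩ := htr 0 2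
    refine apply_one_ne_zero h h01 h10 hhf (hone _ (H.mul_mem hh hh) 0 (by simp [h01, h10])) x hx02
      (hne x hx 0 (by rw [hx02]; decide)) (hne _ (H.mul_mem hh hx) 0 ?_) (hc x hx h hh)
      (hc x hx x hx) (hone _ (H.mul_mem hx hx))
    intro h0
    rw [Perm.mul_apply, hx02, ← h10] at h0
    exact absurd (h.injective h0) (by decide)
  obtain ⟨x, hx, hxl⟩ := htr (label i 1) (label i (.sr 0))
  have hxe := eq_regularRep_sr_zero i x hxl (hc x hx _ hh) (hc x hx x hx)
    (hne x hx (label i 1) (by rw [hxl]; exact fun e => absurd ((label i).injective e) (by decide)))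
    (hone _ (H.mul_mem hx hx))
  rw [hxe] at hx
  have htop : H.comap (regularRep i) = ⊤ :=
    DihedralGroup.three_eq_top (x := .r 1) (y := .sr 0) hh hx (by decide)
  have hle : ∀ g, regularRep i g ∈ H := fun g =>
    Subgroup.mem_comap.1 (htop ▸ Subgroup.mem_top g)
  refine ⟨i, le_antisymm (fun z hz => ?_) ?_⟩
  · obtain ⟨g, hg⟩ := regularRep_transitive i 0 (z 0)
    refine ⟨g, ?_⟩
    have := hone _ (H.mul_mem (H.inv_mem (hle g)) hz) 0 (by simp [← hg])
    exact (inv_mul_eq_one.1 this)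
  · rintro _ ⟨g, rfl⟩
    exact hle g

end Classification

section Presentation

theorem forall_rels_lift_eq_one_iff {f : Gen → Perm (Fin 6)} (hf : f .s = swap 0 1) :
    (∀ r ∈ rels, FreeGroup.lift f r = 1) ↔
      (∀ x ∈ ({f .a1, f .a2, f .b1, f .b2} : Set (Perm (Fin 6))),
        ∀ y ∈ ({f .a1, f .a2, f .b1, f .b2} : Set (Perm (Fin 6))),
          x * (swap 0 1 * y * swap 0 1) = swap 0 1 * y * swap 0 1 * x) ∧
      (f .a1 * (f .b1)⁻¹ * (f .a1)⁻¹ * f .b1) * (f .a2 * (f .b2)⁻¹ * (f .a2)⁻¹ * f .b2) = 1 := by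
  have hs : (swap 0 1 : Perm (Fin 6)) * swap 0 1 = 1 := swap_mul_self 0 1
  have hflip : ∀ {x y : Perm (Fin 6)}, x * (swap 0 1 * y * swap 0 1) = swap 0 1 * y * swap 0 1 * x →
      y * (swap 0 1 * x * swap 0 1) = swap 0 1 * x * swap 0 1 * y := by
    intro x y h
    generalize (swap 0 1 : Perm (Fin 6)) = s at hs h
    calc y * (s * x * s) = s * (s * y * s * x) * s := by
          simp only [← mul_assoc, hs, one_mul]
      _ = s * (x * (s * y * s)) * s := by rw [h]
      _ = s * x * s * y := by simp only [mul_assoc, hs, mul_one]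
  simp only [rels, Set.forall_mem_insert, Set.mem_singleton_iff, forall_eq, map_mul, map_inv,
    FreeGroup.lift_apply_of, hf, swap_inv, hs, inv_one, mul_one, mul_inv_eq_one]
  simp only [← mul_assoc]
  simp only [← mul_assoc] at hflip
  constructor
  · rintro ⟨h₁, h₂, h₃, h₄, h₅, h₆, h₇, h₈, h₉, h₁₀, h₁₁⟩
    exact ⟨⟨⟨h₁.symm, hflip h₅.symm, hflip h₉.symm, hflip h₇.symm⟩,
      ⟨h₅.symm, h₂.symm, h₈.symm, hflip h₁₀.symm⟩,
      ⟨h₉.symm, hflip h₈.symm, h₃.symm, hflip h₆.symm⟩,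
      ⟨h₇.symm, h₁₀.symm, h₆.symm, h₄.symm⟩⟩, h₁₁⟩
  · rintro ⟨⟨⟨h₁, -, -, -⟩, ⟨h₅, h₂, h₈, -⟩, ⟨h₉, -, h₃, -⟩, ⟨h₇, h₁₀, h₆, h₄⟩⟩, h₁₁⟩
    exact ⟨h₁.symm, h₂.symm, h₃.symm, h₄.symm, h₅.symm, h₆.symm, h₇.symm, h₈.symm, h₉.symm,
      h₁₀.symm, h₁₁⟩

theorem CommutesWithConj.closure {α : Type*} [DecidableEq α] {p q : α} {S : Set (Perm α)}
    (h : ∀ x ∈ S, ∀ y ∈ S, x * (swap p q * y * swap p q) = swap p q * y * swap p q * x) :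
    CommutesWithConj p q (Subgroup.closure S) := by
  have hconj : ∀ y, swap p q * y * swap p q = MulAut.conj (swap p q) y := by simp
  simp only [CommutesWithConj, hconj] at h ⊢
  intro x hx y hy
  induction hx, hy using Subgroup.closure_induction₂ with
  | mem x y hx hy => exact h x hx y hy
  | one_left => simp
  | one_right => simp
  | mul_left x y z _ _ _ h₁ h₂ => exact Commute.mul_left h₁ h₂
  | mul_right x y z _ _ _ h₁ h₂ => rw [map_mul]; exact Commute.mul_right h₁ h₂
  | inv_left x y _ _ h => exact Commute.inv_left h
  | inv_right x y _ _ h => rw [map_inv]; exact Commute.inv_right h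

/-- The subgroup generated by the images of `a₁`, `a₂`, `b₁` and `b₂`. -/
def surfaceSubgroup {G : Type*} [Group G] (φ : B →* G) : Subgroup G :=
  Subgroup.closure {φ (PresentedGroup.of .a1), φ (PresentedGroup.of .a2),
    φ (PresentedGroup.of .b1), φ (PresentedGroup.of .b2)}

theorem apply_of_mem_surfaceSubgroup {G : Type*} [Group G] (φ : B →* G) {c : Gen} (hc : c ≠ .s) :
    φ (PresentedGroup.of c) ∈ surfaceSubgroup φ := by
  refine Subgroup.subset_closure ?_
  cases c <;> simp at hc ⊢

theorem transitiveWithSwap_surfaceSubgroup {α : Type*} [DecidableEq α] {p q : α}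
    {φ : B →* Perm α} (hσ : φ σB = swap p q) (ht : ∀ i j, ∃ g, φ g i = j) :
    TransitiveWithSwap p q (surfaceSubgroup φ) := by
  intro U hU hsU i hi j
  have key : ∀ g : B, ∀ k, φ g k ∈ U ↔ k ∈ U := by
    intro g
    have hg : g ∈ Subgroup.closure (Set.range (PresentedGroup.of (rels := rels))) := by
      rw [PresentedGroup.closure_range_of]
      trivial
    induction hg using Subgroup.closure_induction with
    | mem _ h =>
      obtain ⟨c, rfl⟩ := h
      intro k
      by_cases hc : c = .s
      · subst hc
        change φ σB k ∈ U ↔ _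
        rw [hσ]
        exact ⟨fun h => by simpa using hsU _ h, hsU k⟩
      · have hm := apply_of_mem_surfaceSubgroup φ hc
        exact ⟨fun h => by simpa using hU _ (inv_mem hm) _ h, hU _ hm k⟩
    | one => simp
    | mul x y _ _ hx hy =>
      intro k
      rw [map_mul, Perm.mul_apply, hx, hy]
    | inv x _ hx =>
      intro k
      rw [← hx, ← Perm.mul_apply, ← map_mul]
      simp
  obtain ⟨g, rfl⟩ := ht i j
  exact (key g i).2 hi

end Presentation

section Counting

/-- The images of `a₁`, `a₂`, `b₁` and `b₂`. -/
def surfaceTuple {G : Type*} [Group G] (φ : B →* G) : G × G × G × G :=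
  (φ (PresentedGroup.of .a1), φ (PresentedGroup.of .a2), φ (PresentedGroup.of .b1),
    φ (PresentedGroup.of .b2))

theorem ext_surfaceTuple {G : Type*} [Group G] {φ ψ : B →* G} (hσ : φ σB = ψ σB)
    (h : surfaceTuple φ = surfaceTuple ψ) : φ = ψ := by
  simp only [surfaceTuple, Prod.mk.injEq] at h
  refine PresentedGroup.ext fun c => ?_
  cases c
  exacts [h.1, h.2.1, h.2.2.1, h.2.2.2, hσ]

/-- A labelling together with a noncommuting solution in `DihedralGroup 3`. -/
def labelledTuples :
    Finset ((Fin 4 × Bool) × DihedralGroup 3 × DihedralGroup 3 × DihedralGroup 3 ×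
      DihedralGroup 3) :=
  Finset.univ ×ˢ nonabelianTuples

theorem card_labelledTuples : labelledTuples.card = 2880 := by
  rw [labelledTuples, Finset.card_product, card_nonabelianTuples]
  rfl

/-- The tuple in `Perm (Fin 6)` determined by a regular representation of `DihedralGroup 3` and a
tuple in `DihedralGroup 3`. -/
def repTuple (x : (Fin 4 × Bool) × DihedralGroup 3 × DihedralGroup 3 × DihedralGroup 3 ×
    DihedralGroup 3) : Perm (Fin 6) × Perm (Fin 6) × Perm (Fin 6) × Perm (Fin 6) :=
  (regularRep x.1 x.2.1, regularRep x.1 x.2.2.1, regularRep x.1 x.2.2.2.1,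
    regularRep x.1 x.2.2.2.2)

theorem repTuple_injOn : Set.InjOn repTuple labelledTuples := by
  rintro ⟨i, w⟩ hw ⟨j, v⟩ - h
  replace hw := (Finset.mem_product.1 (Finset.mem_coe.1 hw)).2
  simp only [repTuple, Prod.mk.injEq] at h
  obtain ⟨h₁, h₂, h₃, h₄⟩ := h
  have htop : (regularRep j).range.comap (regularRep i) = ⊤ :=
    eq_top_of_mem_nonabelianTuples hw ⟨_, h₁.symm⟩ ⟨_, h₂.symm⟩ ⟨_, h₃.symm⟩ ⟨_, h₄.symm⟩
  obtain ⟨g, hg⟩ := Subgroup.mem_comap.1 (htop ▸ Subgroup.mem_top (DihedralGroup.r 1))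
  obtain rfl := eq_of_regularRep_r_one i j g hg.symm
  have inj := regularRep_injective i
  exact Prod.ext rfl (Prod.ext (inj h₁) (Prod.ext (inj h₂) (Prod.ext (inj h₃) (inj h₄))))

theorem exists_repTuple_eq {φ : B →* Perm (Fin 6)} (hσ : φ σB = swap 0 1)
    (ht : ∀ i j, ∃ g, φ g i = j) :
    ∃ x ∈ labelledTuples, repTuple x = surfaceTuple φ := by
  have hlift : FreeGroup.lift (fun c => φ (PresentedGroup.of c)) =
      φ.comp (PresentedGroup.mk rels) := by
    ext c : 1
    simp [PresentedGroup.of]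
  obtain ⟨hcomm, hsurf⟩ := (forall_rels_lift_eq_one_iff
    (f := fun c => φ (PresentedGroup.of c)) hσ).1 fun r hr => by
      rw [hlift, MonoidHom.comp_apply, PresentedGroup.one_of_mem hr, map_one]
  obtain ⟨i, hi⟩ := (CommutesWithConj.closure hcomm).exists_eq_range
    (transitiveWithSwap_surfaceSubgroup hσ ht)
  have hmem : ∀ c : Gen, c ≠ .s → ∃ g, regularRep i g = φ (PresentedGroup.of c) := fun c hc => by
    have := apply_of_mem_surfaceSubgroup φ hc
    rwa [surfaceSubgroup, hi] at this
  obtain ⟨a₁, h₁⟩ := hmem .a1 (by decide)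
  obtain ⟨a₂, h₂⟩ := hmem .a2 (by decide)
  obtain ⟨b₁, h₃⟩ := hmem .b1 (by decide)
  obtain ⟨b₂, h₄⟩ := hmem .b2 (by decide)
  have inj := regularRep_injective i
  refine ⟨(i, a₁, a₂, b₁, b₂), ?_, by simp only [repTuple, surfaceTuple, h₁, h₂, h₃, h₄]⟩
  rw [labelledTuples, Finset.mem_product, nonabelianTuples, Finset.mem_filter]
  refine ⟨Finset.mem_univ _, Finset.mem_univ _, inj ?_, ?_⟩
  · simpa only [map_mul, map_inv, map_one, h₁, h₂, h₃, h₄] using hsurf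
  · rintro ⟨e₁, e₂, e₃, e₄, e₅, e₆⟩
    rw [← h₁, ← h₂, ← h₃, ← h₄] at hi
    have hab : ∀ x ∈ ({a₁, a₂, b₁, b₂} : Set (DihedralGroup 3)),
        ∀ y ∈ ({a₁, a₂, b₁, b₂} : Set (DihedralGroup 3)), x * y = y * x := by
      simp only [Set.forall_mem_insert, Set.mem_singleton_iff, forall_eq]
      exact ⟨⟨trivial, e₁, e₂, e₃⟩, ⟨e₁.symm, trivial, e₄, e₅⟩, ⟨e₂.symm, e₄.symm, trivial, e₆⟩,
        e₃.symm, e₅.symm, e₆.symm, trivial⟩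
    have htop : Subgroup.closure {a₁, a₂, b₁, b₂} = ⊤ := by
      refine Subgroup.map_injective inj ?_
      rw [MonoidHom.map_closure, ← MonoidHom.range_eq_map, ← hi]
      simp only [Set.image_insert_eq, Set.image_singleton]
    have := Subgroup.isMulCommutative_closure hab
    have hcomm' : (DihedralGroup.r 1 : DihedralGroup 3) * .sr 0 = .sr 0 * .r 1 :=
      setLike_mul_comm (s := Subgroup.closure {a₁, a₂, b₁, b₂}) (by simp [htop]) (by simp [htop])
    exact absurd hcomm' (by decide)

theorem exists_surfaceTuple_eq {i : Fin 4 × Bool} {w} (hw : w ∈ nonabelianTuples) :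
    ∃ φ : B →* Perm (Fin 6), (φ σB = swap 0 1 ∧ ∀ i j, ∃ g, φ g i = j) ∧
      surfaceTuple φ = repTuple (i, w) := by
  let f : Gen → Perm (Fin 6)
    | .a1 => regularRep i w.1
    | .a2 => regularRep i w.2.1
    | .b1 => regularRep i w.2.2.1
    | .b2 => regularRep i w.2.2.2
    | .s => swap 0 1
  have hf : ∀ r ∈ rels, FreeGroup.lift f r = 1 := by
    refine (forall_rels_lift_eq_one_iff rfl).2 ⟨?_, ?_⟩
    · simp only [Set.forall_mem_insert, Set.mem_singleton_iff, forall_eq, f, regularRep_commutes,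
        and_self]
    · rw [nonabelianTuples, Finset.mem_filter] at hw
      simpa only [map_mul, map_inv, map_one] using congrArg (regularRep i) hw.2.1
  let φ : B →* Perm (Fin 6) := PresentedGroup.toGroup hf
  have hφ : ∀ c, φ (PresentedGroup.of c) = f c := fun c => PresentedGroup.toGroup.of hf
  refine ⟨φ, ⟨hφ .s, fun j k => ?_⟩, ?_⟩
  · have htop : φ.range.comap (regularRep i) = ⊤ :=
      eq_top_of_mem_nonabelianTuples hw ⟨_, hφ .a1⟩ ⟨_, hφ .a2⟩ ⟨_, hφ .b1⟩ ⟨_, hφ .b2⟩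
    obtain ⟨g, rfl⟩ := regularRep_transitive i j k
    obtain ⟨b, hb⟩ := Subgroup.mem_comap.1 (htop ▸ Subgroup.mem_top g)
    exact ⟨b, by rw [hb]⟩
  · simp only [surfaceTuple, repTuple, hφ, f]

end Counting

end Braid

/-- There are exactly 2880 homomorphisms φ : B → S₆ with φ(σ) = (1 2) and
transitive image. -/
theorem stmt18 :
    Set.ncard {φ : B →* Equiv.Perm (Fin 6) |
      φ σB = Equiv.swap 0 1 ∧ ∀ i j : Fin 6, ∃ g : B, φ g i = j} = 2880 := by
  have himage : Set.image surfaceTuple {φ : B →* Equiv.Perm (Fin 6) |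
      φ σB = Equiv.swap 0 1 ∧ ∀ i j : Fin 6, ∃ g : B, φ g i = j} =
      Set.image repTuple labelledTuples := by
    ext t
    constructor
    · rintro ⟨φ, ⟨hσ, ht⟩, rfl⟩
      exact exists_repTuple_eq hσ ht
    · rintro ⟨⟨i, w⟩, hw, rfl⟩
      exact exists_surfaceTuple_eq (Finset.mem_product.1 (Finset.mem_coe.1 hw)).2
  rw [← Set.InjOn.ncard_image fun φ hφ ψ hψ => ext_surfaceTuple (hφ.1.trans hψ.1.symm), himage,
    repTuple_injOn.ncard_image, Set.ncard_coe_finset,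
    card_labelledTuples]
end

section
/- There are exactly 172800 group homomorphisms φ: B → S₈ such that φ(σ) is the fixed transposition (1 2), and the image of φ is a transitive subgroup of S₈. -/
open Braid

namespace Braid

open Equiv Subgroup

/-! ### The groups of order eight -/

/-- The triple `(i, j, k)` stands for the element `p ^ i * q ^ j * z ^ k` of a nonabelian group of
order eight generated by `p` and `q`, with `z` the nontrivial central element. -/
abbrev Code : Type := Bool × Bool × Bool

/-- The code of the generator `p`. -/
abbrev Code.p : Code := (true, false, false)

/-- The code of the generator `q`. -/
abbrev Code.q : Code := (false, true, false)

/-- The product of two codes, where `p * p = z ^ α`, `q * q = z ^ β` and `q * p = p * q * z`. -/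
def codeMul (α β : Bool) (c d : Code) : Code :=
  (xor c.1 d.1, xor c.2.1 d.2.1,
    xor (xor c.2.2 d.2.2) (xor (c.2.1 && d.1) (xor (α && c.1 && d.1) (β && c.2.1 && d.2.1))))

/-- The left regular representation on codes. -/
def leftMul (α β : Bool) (c : Code) : Perm Code where
  toFun := codeMul α β c
  invFun := codeMul α β
    (c.1, c.2.1, xor c.2.2 (xor (c.1 && c.2.1) (xor (α && c.1) (β && c.2.1))))
  left_inv := by revert α β c; decide
  right_inv := by revert α β c; decide

/-- The symplectic form recording which pairs of codes fail to commute. -/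
def codeForm (c d : Code) : Bool := xor (c.1 && d.2.1) (c.2.1 && d.1)

/-- The transposition of the codes of `1` and `z`. -/
abbrev codeSwap : Perm Code := swap (false, false, false) (false, false, true)

/-- The group element with a given code. -/
def word {G : Type*} [Group G] (p q z : G) (c : Code) : G :=
  cond c.1 p 1 * cond c.2.1 q 1 * cond c.2.2 z 1

theorem map_word {G G' : Type*} [Group G] [Group G'] (f : G →* G') (p q z : G) (c : Code) :
    f (word p q z c) = word (f p) (f q) (f z) c := by
  obtain ⟨i, j, k⟩ := c
  cases i <;> cases j <;> cases k <;> simp [word]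

theorem word_mem {G : Type*} [Group G] {H : Subgroup G} {p q z : G} (hp : p ∈ H) (hq : q ∈ H)
    (hz : z ∈ H) (c : Code) : word p q z c ∈ H := by
  obtain ⟨i, j, k⟩ := c
  refine mul_mem (mul_mem ?_ ?_) ?_
  · cases i <;> simp [hp]
  · cases j <;> simp [hq]
  · cases k <;> simp [hz]

theorem word_mul {G : Type*} [Group G] {p q z : G} {α β : Bool} (hzz : z * z = 1)
    (hzp : z * p = p * z) (hzq : z * q = q * z) (hqp : q * p = p * q * z)
    (hpp : p * p = cond α z 1) (hqq : q * q = cond β z 1) (c d : Code) :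
    word p q z c * word p q z d = word p q z (codeMul α β c d) := by
  have hzz' (w : G) : z * (z * w) = w := by rw [← mul_assoc, hzz, one_mul]
  have hzp' (w : G) : z * (p * w) = p * (z * w) := by rw [← mul_assoc, hzp, mul_assoc]
  have hzq' (w : G) : z * (q * w) = q * (z * w) := by rw [← mul_assoc, hzq, mul_assoc]
  have hqp' (w : G) : q * (p * w) = p * (q * (z * w)) := by rw [← mul_assoc, hqp]; group
  have hpp' (w : G) : p * (p * w) = cond α z 1 * w := by rw [← mul_assoc, hpp]
  have hqq' (w : G) : q * (q * w) = cond β z 1 * w := by rw [← mul_assoc, hqq]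
  obtain ⟨i, j, k⟩ := c
  obtain ⟨i', j', k'⟩ := d
  rw [mul_assoc] at hqp
  cases α <;> cases β <;> simp only [cond_true, cond_false, one_mul] at hpp hqq hpp' hqq' <;>
    cases i <;> cases j <;> cases k <;> cases i' <;> cases j' <;> cases k' <;>
    simp [word, codeMul, mul_assoc, *]

theorem leftMul_comm (α β : Bool) (c d : Code) :
    leftMul α β c * leftMul α β d = leftMul α β d * leftMul α β c ↔ codeForm c d = false := by
  revert α β c d; decide +kernel

theorem leftMul_swap_comm (α β : Bool) (c d : Code) :
    codeSwap * leftMul α β c * codeSwap * leftMul α β d =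
      leftMul α β d * (codeSwap * leftMul α β c * codeSwap) := by
  revert α β c d; decide +kernel

theorem leftMul_commutator (α β : Bool) (c d : Code) :
    leftMul α β c * (leftMul α β d)⁻¹ * (leftMul α β c)⁻¹ * leftMul α β d =
      leftMul α β (false, false, codeForm c d) := by
  revert α β c d; decide +kernel

theorem leftMul_central_mul_eq_one (α β k l : Bool) :
    leftMul α β (false, false, k) * leftMul α β (false, false, l) = 1 ↔ k = l := by
  revert α β k l; decide +kernel

theorem leftMul_word (α β : Bool) (c : Code) :
    word (leftMul α β Code.p) (leftMul α β Code.q)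
      (leftMul α β Code.p * leftMul α β Code.q * (leftMul α β Code.p)⁻¹ * (leftMul α β Code.q)⁻¹) c
        (false, false, false) = c := by
  revert α β c; decide +kernel

theorem leftMul_apply_one (α β : Bool) (c : Code) : leftMul α β c (false, false, false) = c := by
  revert α β c; decide

/-! ### Normalised quadruples of codes -/

/-- The first pair of indices, in lexicographic order, that are related by `r`. -/
def firstPair (r : Fin 4 → Fin 4 → Bool) : Option (Fin 4 × Fin 4) :=
  [(0, 1), (0, 2), (0, 3), (1, 2), (1, 3), (2, 3)].find? fun m => r m.1 m.2

theorem exists_firstPair {r : Fin 4 → Fin 4 → Bool} (hs : ∀ m n, r m n = r n m)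
    (hi : ∀ m, r m m = false) (h : ∃ m n, r m n = true) :
    ∃ m, firstPair r = some m ∧ r m.1 m.2 = true := by
  cases hf : firstPair r with
  | some m => exact ⟨m, rfl, List.find?_some (p := fun m : Fin 4 × Fin 4 => r m.1 m.2) hf⟩
  | none =>
    obtain ⟨m, n, hmn⟩ := h
    have hnm := (hs m n).symm.trans hmn
    clear hs
    simp only [firstPair, List.find?_eq_none, List.mem_cons, List.not_mem_nil, or_false,
      forall_eq_or_imp, forall_eq] at hf
    fin_cases m <;> fin_cases n <;> simp_all

/-- Quadruples of codes satisfying the relation (TR), whose first noncommuting pair is `(p, q)`. -/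
def IsNormalized (c : Fin 4 → Code) : Prop :=
  codeForm (c 0) (c 1) = codeForm (c 2) (c 3) ∧
    (firstPair fun m n => codeForm (c m) (c n)).any
      (fun m => c m.1 = Code.p ∧ c m.2 = Code.q) = true

instance : DecidablePred IsNormalized := fun _ => inferInstanceAs (Decidable (_ ∧ _))

theorem card_isNormalized : Fintype.card {c // IsNormalized c} = 60 := by
  decide +kernel

/-! ### Subgroups commuting with their conjugate by the transposition -/

section

variable {H : Subgroup (Perm (Fin 8))}

theorem swap_commute_closure {S : Set (Perm (Fin 8))}
    (h : ∀ x ∈ S, ∀ y ∈ S, Commute (swap 0 1 * x * swap 0 1) y) :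
    ∀ x ∈ closure S, ∀ y ∈ closure S, Commute (swap 0 1 * x * swap 0 1) y := by
  intro x hx y hy
  induction hx, hy using closure_induction₂ with
  | mem x y hx hy => exact h x hx y hy
  | one_left y _ => simp
  | one_right x _ => exact Commute.one_right _
  | mul_left x y z _ _ _ h₁ h₂ =>
    have : swap (0 : Fin 8) 1 * (x * y) * swap 0 1 =
        (swap 0 1 * x * swap 0 1) * (swap 0 1 * y * swap 0 1) := by
      simp [mul_assoc]
    rw [this]
    exact h₁.mul_left h₂
  | mul_right y z x _ _ _ h₁ h₂ => exact h₁.mul_right h₂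
  | inv_left x y _ _ h =>
    have : swap (0 : Fin 8) 1 * x⁻¹ * swap 0 1 = (swap 0 1 * x * swap 0 1)⁻¹ := by
      simp [mul_assoc]
    rw [this]
    exact h.inv_left
  | inv_right x y _ _ h => exact h.inv_right

theorem apply_swap_apply {e f : Fin 8}
    (hc : ∀ x ∈ H, ∀ y ∈ H, Commute (swap e f * x * swap e f) y)
    {x y : Perm (Fin 8)} (hx : x ∈ H) (hy : y ∈ H) (i : Fin 8) :
    x (swap e f (y (swap e f i))) = swap e f (y (swap e f (x i))) :=
  (DFunLike.congr_fun (hc y hy x hx).eq i).symm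

/-- The points `0` and `1` meet every orbit. -/
theorem orbit_zero_or_one (ht : ∀ i, ∃ g ∈ closure (insert (swap 0 1) (H : Set (Perm (Fin 8)))),
    g 0 = i) (i : Fin 8) : (∃ x ∈ H, x 0 = i) ∨ ∃ x ∈ H, x 1 = i := by
  have key : ∀ g ∈ closure (insert (swap 0 1) (H : Set (Perm (Fin 8)))), ∀ i,
      ((∃ x ∈ H, x 0 = g i) ∨ ∃ x ∈ H, x 1 = g i) ↔
        ((∃ x ∈ H, x 0 = i) ∨ ∃ x ∈ H, x 1 = i) := by
    intro g hg
    induction hg using closure_induction with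
    | mem g hg =>
      rcases hg with rfl | hg
      · intro i
        have h₀ : (∃ x ∈ H, x 0 = 0) := ⟨1, one_mem H, rfl⟩
        have h₁ : (∃ x ∈ H, x 1 = 1) := ⟨1, one_mem H, rfl⟩
        by_cases hi₀ : i = 0
        · subst hi₀; rw [swap_apply_left]; exact iff_of_true (.inr h₁) (.inl h₀)
        by_cases hi₁ : i = 1
        · subst hi₁; rw [swap_apply_right]; exact iff_of_true (.inl h₀) (.inr h₁)
        rw [swap_apply_of_ne_of_ne hi₀ hi₁]
      · intro i
        have (k : Fin 8) : (∃ x ∈ H, x k = g i) ↔ ∃ x ∈ H, x k = i :=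
          ⟨fun ⟨x, hx, h⟩ => ⟨g⁻¹ * x, mul_mem (inv_mem hg) hx, by simp [h]⟩,
            fun ⟨x, hx, h⟩ => ⟨g * x, mul_mem hg hx, by simp [h]⟩⟩
        rw [this, this]
    | one => simp
    | mul g g' _ _ h h' => intro i; rw [Perm.mul_apply, h, h']
    | inv g _ h => intro i; rw [← h]; simp
  obtain ⟨g, hg, rfl⟩ := ht i
  exact (key g hg 0).2 (Or.inl ⟨1, one_mem H, rfl⟩)

/-- If the transposed points lie in distinct orbits, then these have at most two elements. -/
theorem orbit_subset_pair {e f : Fin 8}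
    (hc : ∀ x ∈ H, ∀ y ∈ H, Commute (swap e f * x * swap e f) y) (h : ∀ x ∈ H, x e ≠ f) :
    ∃ u, ∀ x ∈ H, x e = e ∨ x e = u := by
  have h' : ∀ x ∈ H, x f ≠ e := fun x hx hxf => h x⁻¹ (inv_mem hx) (by simp [← hxf])
  by_cases hf : ∀ y ∈ H, y f = f
  · refine ⟨e, fun x hx => ?_⟩
    by_contra! hxe
    have key := apply_swap_apply hc (inv_mem hx) hx f
    rw [hf _ (inv_mem hx), swap_apply_right, swap_apply_of_ne_of_ne hxe.1 (h x hx)] at key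
    simp at key
    exact hxe.1 key.symm
  · push Not at hf
    obtain ⟨y, hy, hyf⟩ := hf
    refine ⟨y⁻¹ e, fun x hx => or_iff_not_imp_left.2 fun hxe => ?_⟩
    by_contra hyx
    have key := apply_swap_apply hc hx hy e
    have hyx' : y (x e) ≠ e := fun hy' => hyx (Perm.eq_inv_iff_eq.2 hy')
    rw [swap_apply_left, swap_apply_of_ne_of_ne (h' y hy) hyf,
      swap_apply_of_ne_of_ne hxe (h x hx),
      swap_apply_of_ne_of_ne hyx' (h (y * x) (mul_mem hy hx))] at key
    exact h ((x * y)⁻¹ * (y * x)) (mul_mem (inv_mem (mul_mem hx hy)) (mul_mem hy hx))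
      (by simp [← key])

theorem exists_apply_zero_eq_one
    (hc : ∀ x ∈ H, ∀ y ∈ H, Commute (swap 0 1 * x * swap 0 1) y)
    (ht : ∀ i, (∃ x ∈ H, x 0 = i) ∨ ∃ x ∈ H, x 1 = i) : ∃ x ∈ H, x 0 = 1 := by
  by_contra! h
  obtain ⟨u, hu⟩ := orbit_subset_pair hc h
  obtain ⟨v, hv⟩ := orbit_subset_pair (e := 1) (f := 0)
    (by simpa only [swap_comm (1 : Fin 8) 0] using hc)
    (fun x hx hx₁ => h x⁻¹ (inv_mem hx) (by simp [← hx₁]))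
  have : ∀ u v : Fin 8, ∃ i, i ≠ 0 ∧ i ≠ u ∧ i ≠ 1 ∧ i ≠ v := by decide
  obtain ⟨i, h₀, h_u, h₁, h_v⟩ := this u v
  rcases ht i with ⟨x, hx, rfl⟩ | ⟨x, hx, rfl⟩
  · rcases hu x hx with h | h <;> contradiction
  · rcases hv x hx with h | h <;> contradiction

theorem transitive_of_commute (hc : ∀ x ∈ H, ∀ y ∈ H, Commute (swap 0 1 * x * swap 0 1) y)
    (ht : ∀ i, ∃ g ∈ closure (insert (swap 0 1) (H : Set (Perm (Fin 8)))), g 0 = i) (i : Fin 8) :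
    ∃ x ∈ H, x 0 = i := by
  have h := orbit_zero_or_one ht
  obtain ⟨z, hz, hz₀⟩ := exists_apply_zero_eq_one hc h
  rcases h i with h | ⟨x, hx, rfl⟩
  · exact h
  · exact ⟨x * z, mul_mem hx hz, by simp [hz₀]⟩

theorem eq_of_apply_zero_eq (hc : ∀ x ∈ H, ∀ y ∈ H, Commute (swap 0 1 * x * swap 0 1) y)
    (ht : ∀ i, ∃ x ∈ H, x 0 = i) {x y : Perm (Fin 8)} (hx : x ∈ H) (hy : y ∈ H)
    (h : x 0 = y 0) : x = y := by
  obtain ⟨z, hz, hz₀⟩ := ht 1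
  rw [← inv_mul_eq_one]
  have hw : x⁻¹ * y ∈ H := mul_mem (inv_mem hx) hy
  have hw₀ : (x⁻¹ * y) 0 = 0 := by simp [← h]
  generalize x⁻¹ * y = w at hw hw₀
  ext1 i
  obtain ⟨v, hv, hv'⟩ := ht (swap 0 1 i)
  have := apply_swap_apply hc (mul_mem hv (inv_mem hz)) hw 1
  simp only [swap_apply_right, hw₀, swap_apply_left, Perm.mul_apply,
    Perm.inv_eq_iff_eq.2 hz₀.symm, hv', swap_apply_self] at this
  have h₂ := congrArg (swap (0 : Fin 8) 1) this
  rw [swap_apply_self, swap_apply_self] at h₂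
  exact h₂.symm

theorem mul_self_eq_one_of_apply_zero
    (hc : ∀ x ∈ H, ∀ y ∈ H, Commute (swap 0 1 * x * swap 0 1) y)
    (ht : ∀ i, ∃ x ∈ H, x 0 = i) {z : Perm (Fin 8)} (hz : z ∈ H) (hz₀ : z 0 = 1) : z * z = 1 := by
  by_cases h₁ : z 1 = 0
  · exact eq_of_apply_zero_eq hc ht (mul_mem hz hz) (one_mem H) (by simp [hz₀, h₁])
  have h₁' : z 1 ≠ 1 := fun h => by simpa using z.injective (h.trans hz₀.symm)
  have key := apply_swap_apply hc hz hz 0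
  rw [swap_apply_left, hz₀, swap_apply_right, swap_apply_of_ne_of_ne h₁ h₁', hz₀,
    swap_apply_right] at key
  have h₃ : z ^ 3 ^ 1 = 1 :=
    eq_of_apply_zero_eq hc ht (pow_mem hz _) (one_mem H) (by simp [pow_succ, hz₀, key])
  obtain ⟨i, hi⟩ := Perm.exists_fixed_point_of_prime (p := 3) (by decide) h₃
  obtain ⟨x, hx, rfl⟩ := ht i
  have := eq_of_apply_zero_eq hc ht (mul_mem hz hx) hx hi
  rw [mul_eq_right] at this
  simp [this] at hz₀

theorem central_of_apply_zero
    (hc : ∀ x ∈ H, ∀ y ∈ H, Commute (swap 0 1 * x * swap 0 1) y)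
    (ht : ∀ i, ∃ x ∈ H, x 0 = i) {z y : Perm (Fin 8)} (hz : z ∈ H) (hz₀ : z 0 = 1) (hy : y ∈ H) :
    z * y = y * z := by
  have hzz := mul_self_eq_one_of_apply_zero hc ht hz hz₀
  by_cases h₀ : y 0 = 0
  · rw [eq_of_apply_zero_eq hc ht hy (one_mem H) h₀, one_mul, mul_one]
  by_cases h₁ : y 0 = 1
  · rw [eq_of_apply_zero_eq hc ht hy hz (h₁.trans hz₀.symm)]
  have h₂ : y 1 ≠ 0 := fun h => h₁ <| by
    have := eq_of_apply_zero_eq hc ht (mul_mem hy hz) (one_mem H) (by simp [hz₀, h])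
    rw [mul_eq_one_iff_eq_inv.1 this, inv_eq_of_mul_eq_one_right hzz, hz₀]
  have h₃ : y 1 ≠ 1 := fun h => h₀ <| by
    have := eq_of_apply_zero_eq hc ht (mul_mem hy hz) hz (by simp [hz₀, h])
    rw [mul_eq_right.1 this, Perm.one_apply]
  have key := apply_swap_apply hc hz hy 0
  rw [swap_apply_left, hz₀, swap_apply_right, swap_apply_of_ne_of_ne h₂ h₃,
    swap_apply_of_ne_of_ne h₀ h₁] at key
  have := eq_of_apply_zero_eq hc ht (mul_mem hz (mul_mem hy hz)) hy (by simp [hz₀, key])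
  calc z * y = z * (y * z) * z := by rw [mul_assoc, mul_assoc y, hzz, mul_one]
    _ = y * z := by rw [this]

theorem mul_eq_mul_central
    (hc : ∀ x ∈ H, ∀ y ∈ H, Commute (swap 0 1 * x * swap 0 1) y)
    (ht : ∀ i, ∃ x ∈ H, x 0 = i) {z x y : Perm (Fin 8)} (hz : z ∈ H) (hz₀ : z 0 = 1)
    (hx : x ∈ H) (hy : y ∈ H) (hx₁ : x ≠ 1) (hxz : x ≠ z) (hy₁ : y ≠ 1) (hyz : y ≠ z)
    (h₁ : y * x ≠ 1) (h_z : y * x ≠ z) : x * y * z = y * x := by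
  have hne {w : Perm (Fin 8)} (hw : w ∈ H) (h₁ : w ≠ 1) (h₂ : w ≠ z) : w 0 ≠ 0 ∧ w 0 ≠ 1 :=
    ⟨fun h => h₁ (eq_of_apply_zero_eq hc ht hw (one_mem H) h),
      fun h => h₂ (eq_of_apply_zero_eq hc ht hw hz (h.trans hz₀.symm))⟩
  have hyz' : y * z ≠ 1 := fun h => hyz <| by
    rw [mul_eq_one_iff_eq_inv.1 h,
      inv_eq_of_mul_eq_one_right (mul_self_eq_one_of_apply_zero hc ht hz hz₀)]
  obtain ⟨h₀, h₀'⟩ := hne hx hx₁ hxz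
  obtain ⟨hyz₀, hyz₁⟩ := hne (mul_mem hy hz) hyz' (by simpa using hy₁)
  obtain ⟨hyx₀, hyx₁⟩ := hne (mul_mem hy hx) h₁ h_z
  simp only [Perm.mul_apply, hz₀] at hyz₀ hyz₁ hyx₀ hyx₁
  have key := apply_swap_apply hc hx hy 0
  rw [swap_apply_left, swap_apply_of_ne_of_ne hyz₀ hyz₁, swap_apply_of_ne_of_ne h₀ h₀',
    swap_apply_of_ne_of_ne hyx₀ hyx₁] at key
  exact eq_of_apply_zero_eq hc ht (mul_mem (mul_mem hx hy) hz) (mul_mem hy hx)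
    (by simp [hz₀, key])

theorem mul_self_mem_pair
    (hc : ∀ x ∈ H, ∀ y ∈ H, Commute (swap 0 1 * x * swap 0 1) y)
    (ht : ∀ i, ∃ x ∈ H, x 0 = i) {z x : Perm (Fin 8)} (hz : z ∈ H) (hz₀ : z 0 = 1)
    (hx : x ∈ H) : ∃ α : Bool, x * x = cond α z 1 := by
  by_contra! h
  have h₁ : x * x ≠ 1 := h false
  have h_z : x * x ≠ z := h true
  have hx₁ : x ≠ 1 := fun h => h₁ (by simp [h])
  have hxz : x ≠ z := fun h => h₁ (by rw [h, mul_self_eq_one_of_apply_zero hc ht hz hz₀])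
  have := mul_eq_mul_central hc ht hz hz₀ hx hx hx₁ hxz hx₁ hxz h₁ h_z
  rw [mul_eq_left] at this
  simp [this] at hz₀

theorem mul_eq_mul_central_of_not_commute
    (hc : ∀ x ∈ H, ∀ y ∈ H, Commute (swap 0 1 * x * swap 0 1) y)
    (ht : ∀ i, ∃ x ∈ H, x 0 = i) {z x y : Perm (Fin 8)} (hz : z ∈ H) (hz₀ : z 0 = 1)
    (hx : x ∈ H) (hy : y ∈ H) (hxy : ¬ Commute x y) : x * y * z = y * x := by
  have hcz {w : Perm (Fin 8)} (hw : w ∈ H) : Commute z w :=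
    central_of_apply_zero hc ht hz hz₀ hw
  refine mul_eq_mul_central hc ht hz hz₀ hx hy ?_ ?_ ?_ ?_ ?_ ?_
  · rintro rfl; exact hxy (Commute.one_left y)
  · rintro rfl; exact hxy (hcz hy)
  · rintro rfl; exact hxy (Commute.one_right x)
  · rintro rfl; exact hxy (hcz hx).symm
  · intro h
    rw [mul_eq_one_iff_eq_inv.1 h] at hxy
    exact hxy (Commute.refl x).inv_right
  · intro h
    rw [← eq_mul_inv_iff_mul_eq] at h
    rw [h] at hxy
    exact hxy ((hcz hx).symm.mul_right (Commute.refl x).inv_right)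

theorem exists_not_commute
    (hc : ∀ x ∈ H, ∀ y ∈ H, Commute (swap 0 1 * x * swap 0 1) y)
    (ht : ∀ i, ∃ x ∈ H, x 0 = i) : ∃ x ∈ H, ∃ y ∈ H, ¬ Commute x y := by
  by_contra! h
  obtain ⟨z, hz, hz₀⟩ := ht 1
  obtain ⟨x, hx, hx₀⟩ := ht 2
  have : ∀ u v : Fin 8, ∃ i, i ≠ 0 ∧ i ≠ 1 ∧ i ≠ u ∧ i ≠ v := by decide
  obtain ⟨i, h₀, h₁, hu, hv⟩ := this (x⁻¹ 0) ((z * x⁻¹) 0)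
  obtain ⟨y, hy, rfl⟩ := ht i
  have := mul_eq_mul_central hc ht hz hz₀ hx hy (by rintro rfl; simp at hx₀)
    (by rintro rfl; simp [hx₀] at hz₀) (by rintro rfl; simp at h₀)
    (by rintro rfl; exact h₁ hz₀) (fun h => hu (by rw [mul_eq_one_iff_eq_inv.1 h]))
    (fun h => hv (by rw [← eq_mul_inv_iff_mul_eq.2 h]))
  rw [(h x hx y hy).eq, mul_eq_left] at this
  simp [this] at hz₀

theorem code_eq_of_word_eq_one {G : Type*} [Group G] {p q z : G} (hpq : ¬ Commute p q)
    (hzp : Commute z p) (hzq : Commute z q) (hz : z ≠ 1) {c : Code} (h : word p q z c = 1) :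
    c = (false, false, false) := by
  obtain ⟨i, j, k⟩ := c
  have hkp : Commute p (cond k z 1) := by cases k <;> simp [hzp.symm]
  have hkq : Commute q (cond k z 1) := by cases k <;> simp [hzq.symm]
  have hip : Commute p (cond i p 1) := by cases i <;> simp
  cases j
  · cases i
    · cases k
      · rfl
      · exact absurd (by simpa [word] using h) hz
    · refine absurd ?_ hpq
      rw [eq_inv_of_mul_eq_one_left (a := p) (b := cond k z 1) (by simpa [word] using h)]
      exact hkq.inv_right.symm
  · refine absurd ?_ hpq
    have hq : q = (cond i p 1)⁻¹ * (cond k z 1)⁻¹ := by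
      rw [eq_mul_inv_iff_mul_eq, eq_inv_iff_mul_eq_one, mul_eq_one_comm, ← mul_assoc]
      exact h
    rw [hq]
    exact hip.inv_right.mul_right hkp.inv_right

/-- Two noncommuting elements label the eight points by codes, and all elements act in these labels
by left multiplication. -/
theorem exists_labelling
    (hc : ∀ x ∈ H, ∀ y ∈ H, Commute (swap 0 1 * x * swap 0 1) y)
    (ht : ∀ i, ∃ x ∈ H, x 0 = i) {p q : Perm (Fin 8)} (hp : p ∈ H) (hq : q ∈ H)
    (hpq : ¬ Commute p q) :
    ∃ (α β : Bool) (g : Code ≃ Fin 8), g (false, false, false) = 0 ∧ g (false, false, true) = 1 ∧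
      g Code.p = p 0 ∧ g Code.q = q 0 ∧
        ∀ x ∈ H, g.permCongrHom (leftMul α β (g.symm (x 0))) = x := by
  obtain ⟨z, hz, hz₀⟩ := ht 1
  obtain ⟨α, hα⟩ := mul_self_mem_pair hc ht hz hz₀ hp
  obtain ⟨β, hβ⟩ := mul_self_mem_pair hc ht hz hz₀ hq
  have hzz := mul_self_eq_one_of_apply_zero hc ht hz hz₀
  have hzp := central_of_apply_zero hc ht hz hz₀ hp
  have hzq := central_of_apply_zero hc ht hz hz₀ hq
  have hqp := (mul_eq_mul_central_of_not_commute hc ht hz hz₀ hp hq hpq).symm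
  have hmul := word_mul hzz hzp hzq hqp hα hβ
  have hz₁ : z ≠ 1 := by rintro rfl; simp at hz₀
  have hmem := word_mem hp hq hz
  have hinj : Function.Injective fun c => word p q z c 0 := by
    intro c d hcd
    have hcd' := eq_of_apply_zero_eq hc ht (hmem c) (hmem d) hcd
    obtain ⟨e, rfl⟩ := (leftMul α β d).surjective c
    have he : word p q z e = 1 := by
      rw [← mul_eq_left (a := word p q z d), hmul]; exact hcd'
    rw [code_eq_of_word_eq_one hpq hzp hzq hz₁ he, leftMul_apply_one]
  have hcard : Fintype.card Code = Fintype.card (Fin 8) := rfl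
  let g : Code ≃ Fin 8 :=
    ofBijective _ ((Fintype.bijective_iff_injective_and_card _).2 ⟨hinj, hcard⟩)
  have hg (c : Code) : g c = word p q z c 0 := rfl
  refine ⟨α, β, g, by simp [hg, word], by simp [hg, word, hz₀], by simp [hg, word],
    by simp [hg, word], fun x hx => ?_⟩
  obtain ⟨c, hxc⟩ := g.surjective (x 0)
  rw [← eq_of_apply_zero_eq hc ht (hmem c) hx hxc, ← hg, g.symm_apply_apply]
  ext1 i
  obtain ⟨d, rfl⟩ := g.surjective i
  simp only [permCongrHom_coe, permCongr_apply, symm_apply_apply]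
  rw [hg, hg, ← Perm.mul_apply, hmul]
  rfl

end

/-! ### Admissible quadruples of permutations -/

/-- The images of the generators `a₁, b₁, a₂, b₂` under a homomorphism of `B` to `S₈` sending `σ` to
`swap 0 1` with transitive image. -/
structure IsAdmissible (a : Fin 4 → Perm (Fin 8)) : Prop where
  comm : ∀ m n, Commute (swap 0 1 * a m * swap 0 1) (a n)
  tr : a 0 * (a 1)⁻¹ * (a 0)⁻¹ * a 1 * (a 2 * (a 3)⁻¹ * (a 2)⁻¹ * a 3) = 1
  trans : ∀ i, ∃ g ∈ closure (insert (swap 0 1) (Set.range a)), g 0 = i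

/-- Labellings of the eight points by codes with `1` at the point `0` and `z` at the point `1`. -/
abbrev Labelling : Type :=
  {g : Code ≃ Fin 8 // g (false, false, false) = 0 ∧ g (false, false, true) = 1}

/-- The standard labelling. -/
def standardLabelling : Code ≃ Fin 8 where
  toFun c := 4 * (cond c.1 1 0) + 2 * (cond c.2.1 1 0) + cond c.2.2 1 0
  invFun i := (decide (4 ≤ i.val), decide (i.val % 4 ≥ 2), decide (i.val % 2 = 1))
  left_inv := by decide
  right_inv := by decide

theorem card_labelling : Nat.card Labelling = 720 := by
  have e : Labelling ≃ {f : Perm (Fin 8) // ∀ i, ¬ 2 ≤ i → f i = i} :=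
    (standardLabelling.equivCongr (Equiv.refl _)).subtypeEquiv fun g => by
      constructor
      · rintro ⟨h₀, h₁⟩ i hi
        have : i = 0 ∨ i = 1 := by omega
        rcases this with rfl | rfl
        · exact h₀
        · exact h₁
      · exact fun h => ⟨h 0 (by decide), h 1 (by decide)⟩
  rw [Nat.card_congr (e.trans (Perm.subtypeEquivSubtypePerm fun i : Fin 8 => 2 ≤ i).symm),
    Nat.card_eq_fintype_card, Fintype.card_perm]
  rfl

/-- The combinatorial data describing admissible quadruples. -/
abbrev Datum : Type := Labelling × Bool × Bool × {c : Fin 4 → Code // IsNormalized c}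

theorem card_datum : Nat.card Datum = 172800 := by
  simp only [Nat.card_prod, card_labelling]
  simp [card_isNormalized]

/-- The quadruple of permutations described by a datum. -/
def Datum.perm (d : Datum) (m : Fin 4) : Perm (Fin 8) :=
  d.1.1.permCongrHom (leftMul d.2.1 d.2.2.1 (d.2.2.2.1 m))

theorem permCongrHom_codeSwap (g : Labelling) : g.1.permCongrHom codeSwap = swap 0 1 := by
  exact (symm_trans_swap_trans _ _ g.1).trans (by rw [g.2.1, g.2.2])

theorem IsNormalized.exists_pair {c : Fin 4 → Code} (hc : IsNormalized c) :
    ∃ m, (firstPair fun m n => codeForm (c m) (c n)) = some m ∧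
      c m.1 = Code.p ∧ c m.2 = Code.q := by
  simpa [Option.any_eq_true] using hc.2

/-- The point with code `c`, expressed through the permutations with codes `p` and `q`. -/
theorem Labelling.word_apply (g : Labelling) (α β : Bool) {P Q : Perm (Fin 8)}
    (hP : P = g.1.permCongrHom (leftMul α β Code.p))
    (hQ : Q = g.1.permCongrHom (leftMul α β Code.q)) (c : Code) :
    word P Q (P * Q * P⁻¹ * Q⁻¹) c 0 = g.1 c := by
  have := map_word g.1.permCongrHom.toMonoidHom (leftMul α β Code.p) (leftMul α β Code.q)
      (leftMul α β Code.p * leftMul α β Code.q * (leftMul α β Code.p)⁻¹ * (leftMul α β Code.q)⁻¹) c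
  simp only [map_mul, map_inv, MulEquiv.coe_toMonoidHom, ← hP, ← hQ] at this
  rw [← this, permCongrHom_coe, permCongr_apply, (symm_apply_eq g.1).2 g.2.1.symm,
    leftMul_word]

theorem Datum.isAdmissible (d : Datum) : IsAdmissible d.perm where
  comm m n := by
    obtain ⟨g, α, β, c, hc⟩ := d
    have := congrArg g.1.permCongrHom (leftMul_swap_comm α β (c m) (c n))
    simp only [map_mul, permCongrHom_codeSwap] at this
    exact this
  tr := by
    obtain ⟨g, α, β, c, hc⟩ := d
    have := congrArg g.1.permCongrHom
      ((leftMul_central_mul_eq_one α β _ _).2 hc.1)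
    rw [← leftMul_commutator, ← leftMul_commutator] at this
    simp only [map_mul, map_inv, map_one] at this
    exact this
  trans i := by
    obtain ⟨g, α, β, c, hc⟩ := d
    obtain ⟨⟨m, n⟩, -, hm, hn⟩ := hc.exists_pair
    obtain ⟨x, rfl⟩ := g.1.surjective i
    rw [← g.word_apply α β (congrArg (fun x => g.1.permCongrHom (leftMul α β x)) hm)
      (congrArg (fun x => g.1.permCongrHom (leftMul α β x)) hn) x]
    have hmem (l : Fin 4) : g.1.permCongrHom (leftMul α β (c l)) ∈
        closure (insert (swap 0 1) (Set.range (Datum.perm (g, α, β, ⟨c, hc⟩)))) :=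
      Subgroup.subset_closure (Or.inr ⟨l, rfl⟩)
    exact ⟨_, word_mem (hmem m) (hmem n)
      (mul_mem (mul_mem (mul_mem (hmem m) (hmem n)) (inv_mem (hmem m))) (inv_mem (hmem n))) x, rfl⟩

/-- The first noncommuting pair of a quadruple. -/
def noncommPair {G : Type*} [Mul G] [DecidableEq G] (a : Fin 4 → G) : Option (Fin 4 × Fin 4) :=
  firstPair fun m n => decide (a m * a n ≠ a n * a m)

theorem noncommPair_permCongrHom (g : Code ≃ Fin 8) (α β : Bool) (c : Fin 4 → Code) :
    noncommPair (fun m => g.permCongrHom (leftMul α β (c m))) =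
      firstPair fun m n => codeForm (c m) (c n) := by
  unfold noncommPair
  congr 1
  ext m n
  simp only [← map_mul, ne_eq, EmbeddingLike.apply_eq_iff_eq, leftMul_comm]
  simp

theorem Datum.perm_injective : Function.Injective Datum.perm := by
  rintro ⟨g, α, β, c, hc⟩ ⟨g', α', β', c', hc'⟩ h
  have hl (l : Fin 4) : g.1.permCongrHom (leftMul α β (c l)) =
      g'.1.permCongrHom (leftMul α' β' (c' l)) := congrFun h l
  obtain ⟨⟨m, n⟩, hmn, hm, hn⟩ := hc.exists_pair
  obtain ⟨⟨m', n'⟩, hmn', hm', hn'⟩ := hc'.exists_pair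
  have hpair := congrArg noncommPair (funext hl)
  rw [noncommPair_permCongrHom, noncommPair_permCongrHom, hmn, hmn'] at hpair
  obtain ⟨rfl, rfl⟩ : m = m' ∧ n = n' := by simpa using hpair
  dsimp only at hm hm' hn hn'
  have hp := hl m
  have hq := hl n
  rw [hm, hm'] at hp
  rw [hn, hn'] at hq
  obtain rfl : g = g' := Subtype.ext <| Equiv.ext fun x =>
    (g.word_apply α β rfl rfl x).symm.trans (g'.word_apply α' β' hp hq x)
  simp only [EmbeddingLike.apply_eq_iff_eq] at hl hp hq
  have hα : α = α' := by
    simpa [leftMul, codeMul] using congrArg (fun f => (f Code.p).2.2) hp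
  have hβ : β = β' := by
    simpa [leftMul, codeMul] using congrArg (fun f => (f Code.q).2.2) hq
  obtain rfl : c = c' := funext fun l => by
    rw [← leftMul_apply_one α β (c l), hl, leftMul_apply_one]
  rw [hα, hβ]

theorem IsAdmissible.exists_datum {a : Fin 4 → Perm (Fin 8)} (ha : IsAdmissible a) :
    ∃ d : Datum, d.perm = a := by
  have hc := swap_commute_closure (S := Set.range a) (by
    rintro _ ⟨m, rfl⟩ _ ⟨n, rfl⟩; exact ha.comm m n)
  have ht := transitive_of_commute hc fun i => by
    obtain ⟨g, hg, hi⟩ := ha.trans i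
    exact ⟨g, closure_mono (Set.insert_subset_insert Subgroup.subset_closure) hg, hi⟩
  have hnc : ∃ m n, a m * a n ≠ a n * a m := by
    by_contra! h
    obtain ⟨x, hx, y, hy, hxy⟩ := exists_not_commute hc ht
    have := Subgroup.isMulCommutative_closure (k := Set.range a) (by
      rintro _ ⟨m, rfl⟩ _ ⟨n, rfl⟩; exact h m n)
    exact hxy (setLike_mul_comm hx hy)
  obtain ⟨⟨m, n⟩, hmn, hne⟩ :=
    exists_firstPair (r := fun m n => decide (a m * a n ≠ a n * a m))
      (fun m n => by simp only [ne_comm]) (by simp) (by simpa using hnc)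
  have hmem (l : Fin 4) : a l ∈ closure (Set.range a) := subset_closure ⟨l, rfl⟩
  obtain ⟨α, β, g, h₀, h₁, hp, hq, hg⟩ :=
    exists_labelling hc ht (hmem m) (hmem n) (of_decide_eq_true (p := a m * a n ≠ a n * a m) hne)
  let c : Fin 4 → Code := fun l => g.symm (a l 0)
  have hgc : (fun l => g.permCongrHom (leftMul α β (c l))) = a := funext fun l => hg _ (hmem l)
  refine ⟨(⟨g, h₀, h₁⟩, α, β, ⟨c, ?_, ?_⟩), hgc⟩
  · rw [← leftMul_central_mul_eq_one α β, ← leftMul_commutator, ← leftMul_commutator,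
      ← g.permCongrHom.map_eq_one_iff]
    have htr := ha.tr
    rw [← hgc] at htr
    simpa only [map_mul, map_inv] using htr
  · have : (firstPair fun m n => codeForm (c m) (c n)) = some (m, n) := by
      rw [← noncommPair_permCongrHom g α β, hgc]
      exact hmn
    simp [this, c, ← hp, ← hq]

/-! ### Homomorphisms and admissible quadruples -/

/-- The images of the generators `a₁, b₁, a₂, b₂`. -/
def generatorImages (φ : B →* Perm (Fin 8)) : Fin 4 → Perm (Fin 8) :=
  ![φ (PresentedGroup.of Gen.a1), φ (PresentedGroup.of Gen.b1), φ (PresentedGroup.of Gen.a2),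
    φ (PresentedGroup.of Gen.b2)]

/-- The values on the generators of `B` prescribed by a quadruple. -/
def generatorValue (a : Fin 4 → Perm (Fin 8)) : Gen → Perm (Fin 8)
  | .a1 => a 0
  | .b1 => a 1
  | .a2 => a 2
  | .b2 => a 3
  | .s => swap 0 1

theorem apply_of_eq_generatorValue {φ : B →* Perm (Fin 8)} (hφ : φ σB = swap 0 1) (x : Gen) :
    φ (PresentedGroup.of x) = generatorValue (generatorImages φ) x := by
  cases x <;> first | rfl | exact hφ

theorem range_generatorValue (a : Fin 4 → Perm (Fin 8)) :
    Set.range (generatorValue a) = insert (swap 0 1) (Set.range a) := by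
  ext x
  constructor
  · rintro ⟨y, rfl⟩
    cases y
    exacts [.inr ⟨0, rfl⟩, .inr ⟨2, rfl⟩, .inr ⟨1, rfl⟩, .inr ⟨3, rfl⟩, .inl rfl]
  · rintro (rfl | ⟨m, rfl⟩)
    · exact ⟨.s, rfl⟩
    · fin_cases m
      exacts [⟨.a1, rfl⟩, ⟨.b1, rfl⟩, ⟨.a2, rfl⟩, ⟨.b2, rfl⟩]

theorem range_eq_closure {φ : B →* Perm (Fin 8)} (hφ : φ σB = swap 0 1) :
    φ.range = closure (insert (swap 0 1) (Set.range (generatorImages φ))) := by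
  rw [MonoidHom.range_eq_map, ← PresentedGroup.closure_range_of, MonoidHom.map_closure,
    ← Set.range_comp, ← range_generatorValue]
  congr 2
  exact funext (apply_of_eq_generatorValue hφ)

theorem transitive_iff {φ : B →* Perm (Fin 8)} (hφ : φ σB = swap 0 1) :
    (∀ i j : Fin 8, ∃ g : B, φ g i = j) ↔
      ∀ i, ∃ g ∈ closure (insert (swap 0 1) (Set.range (generatorImages φ))), g 0 = i := by
  simp only [← range_eq_closure hφ, MonoidHom.mem_range, exists_exists_eq_and]
  refine ⟨fun h => h 0, fun h i j => ?_⟩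
  obtain ⟨g, rfl⟩ := h i
  obtain ⟨g', rfl⟩ := h j
  exact ⟨g' * g⁻¹, by simp⟩

theorem swap_commute_comm {x y : Perm (Fin 8)} :
    Commute (swap 0 1 * x * swap 0 1) y ↔ Commute (swap 0 1 * y * swap 0 1) x := by
  have key {x y : Perm (Fin 8)} (h : Commute (swap 0 1 * x * swap 0 1) y) :
      Commute (swap 0 1 * y * swap 0 1) x := by
    have := congrArg (fun w => swap 0 1 * w * swap 0 1) h.eq
    simp only [mul_assoc, swap_mul_self_mul, swap_mul_self, mul_one] at this
    simp only [Commute, SemiconjBy, mul_assoc, this]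
  exact ⟨key, key⟩

theorem lift_generatorValue_eq_one_iff (a : Fin 4 → Perm (Fin 8)) :
    (∀ w ∈ rels, FreeGroup.lift (generatorValue a) w = 1) ↔
      (∀ m n, Commute (swap 0 1 * a m * swap 0 1) (a n)) ∧
        a 0 * (a 1)⁻¹ * (a 0)⁻¹ * a 1 * (a 2 * (a 3)⁻¹ * (a 2)⁻¹ * a 3) = 1 := by
  have hs (x y : Perm (Fin 8)) : swap 0 1 * x * swap 0 1 * y = y * swap 0 1 * x * swap 0 1 ↔
      Commute (swap 0 1 * x * swap 0 1) y := by
    simp only [Commute, SemiconjBy, mul_assoc]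
  simp only [rels, Set.mem_insert_iff, Set.mem_singleton_iff, forall_eq_or_imp, forall_eq, map_mul,
    map_inv, FreeGroup.lift_apply_of, generatorValue, swap_inv, swap_mul_self, mul_inv_eq_one, hs]
  constructor
  · rintro ⟨h₀₀, h₂₂, h₁₁, h₃₃, h₀₂, h₁₃, h₀₃, h₁₂, h₀₁, h₂₃, h⟩
    refine ⟨fun m n => ?_, h⟩
    fin_cases m <;> fin_cases n <;> first | assumption | (rw [swap_commute_comm]; assumption)
  · rintro ⟨h, h'⟩
    exact ⟨h 0 0, h 2 2, h 1 1, h 3 3, h 0 2, h 1 3, h 0 3, h 1 2, h 0 1, h 2 3, h'⟩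

theorem lift_generatorValue_generatorImages {φ : B →* Perm (Fin 8)} (hφ : φ σB = swap 0 1)
    {w : FreeGroup Gen} (hw : w ∈ rels) :
    FreeGroup.lift (generatorValue (generatorImages φ)) w = 1 := by
  have : FreeGroup.lift (generatorValue (generatorImages φ)) =
      φ.comp (PresentedGroup.mk rels) := by
    ext1 x
    rw [FreeGroup.lift_apply_of]
    exact (apply_of_eq_generatorValue hφ x).symm
  rw [this, MonoidHom.comp_apply, PresentedGroup.one_of_mem hw, map_one]

theorem generatorImages_injOn :
    Set.InjOn generatorImages {φ : B →* Perm (Fin 8) | φ σB = swap 0 1} := by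
  intro φ hφ ψ hψ h
  refine PresentedGroup.ext fun x => ?_
  rw [apply_of_eq_generatorValue hφ, apply_of_eq_generatorValue hψ, h]

theorem image_generatorImages :
    generatorImages '' {φ : B →* Perm (Fin 8) |
      φ σB = swap 0 1 ∧ ∀ i j : Fin 8, ∃ g : B, φ g i = j} = {a | IsAdmissible a} := by
  ext a
  constructor
  · rintro ⟨φ, ⟨hφ, ht⟩, rfl⟩
    obtain ⟨hc, htr⟩ := (lift_generatorValue_eq_one_iff _).1 fun w hw =>
      lift_generatorValue_generatorImages hφ hw
    exact ⟨hc, htr, (transitive_iff hφ).1 ht⟩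
  · intro ha
    have hrel := (lift_generatorValue_eq_one_iff a).2 ⟨ha.comm, ha.tr⟩
    have hσ : PresentedGroup.toGroup hrel σB = swap 0 1 := PresentedGroup.toGroup.of hrel
    have him : generatorImages (PresentedGroup.toGroup hrel) = a := by
      ext1 m
      fin_cases m <;> exact PresentedGroup.toGroup.of hrel
    exact ⟨PresentedGroup.toGroup hrel,
      ⟨hσ, (transitive_iff hσ).2 (by rw [him]; exact ha.trans)⟩, him⟩

end Braid

/-- There are exactly 172800 homomorphisms φ : B → S₈ with φ(σ) = (1 2) and
transitive image. -/
theorem stmt19 :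
    Set.ncard {φ : B →* Equiv.Perm (Fin 8) |
      φ σB = Equiv.swap 0 1 ∧ ∀ i j : Fin 8, ∃ g : B, φ g i = j} = 172800 := by
  have hrange : {a | IsAdmissible a} = Set.range Datum.perm :=
    Set.ext fun a => ⟨IsAdmissible.exists_datum, by rintro ⟨d, rfl⟩; exact d.isAdmissible⟩
  rw [← (generatorImages_injOn.mono fun φ hφ => hφ.1).ncard_image,
    image_generatorImages, hrange, Set.ncard_range_of_injective Datum.perm_injective, card_datum]
end
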